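/- Let (Ω, ℱ₂, P) be a probability space with sub-σ-algebra ℱ₁ ⊆ ℱ₂. Then ℱ₂ is atomless conditionally to ℱ₁ if and only if there exists a random variable U : Ω → [0,1] that is ℱ₂-measurable, uniformly distributed on [0,1], and independent of ℱ₁, such that the increasing family of sets B_t = {U ≤ t}, t ∈ [0,1], satisfies E[1_{B_t} ∣ ℱ₁] = t almost surely for every t ∈ [0,1]. -/

import Mathlib

open MeasureTheory ProbabilityTheory

/-- The conditional expectation of the indicator of a set, as a real-valued function. -/
noncomputable def condIndicator {Ω : Type*} (m1 : MeasurableSpace Ω) [MeasurableSpace Ω]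
    (μ : Measure Ω) (A : Set Ω) : Ω → ℝ :=
  μ[A.indicator (fun _ => (1 : ℝ)) | m1]

/-- The ambient σ-algebra is atomless conditionally to `m1`: for every measurable set `A`
there is a measurable `B ⊆ A` with `0 < E[1_B ∣ m1] < E[1_A ∣ m1]` a.s. on
`{E[1_A ∣ m1] > 0}`. -/
def CondAtomless {Ω : Type*} (m1 : MeasurableSpace Ω) [MeasurableSpace Ω]
    (μ : Measure Ω) : Prop :=
  ∀ A : Set Ω, MeasurableSet A →
    ∃ B : Set Ω, MeasurableSet B ∧ B ⊆ A ∧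
      ∀ᵐ ω ∂μ, 0 < condIndicator m1 μ A ω →
        0 < condIndicator m1 μ B ω ∧ condIndicator m1 μ B ω < condIndicator m1 μ A ω

/-- Two real random variables are commonotone if both are a.s. equal to nondecreasing
functions of a common random variable. -/
def Commonotone {Ω : Type*} [MeasurableSpace Ω] (μ : Measure Ω) (ξ η : Ω → ℝ) : Prop :=
  ∃ (f g : ℝ → ℝ) (ζ : Ω → ℝ), Monotone f ∧ Monotone g ∧ Measurable ζ ∧
    ξ =ᵐ[μ] (fun ω => f (ζ ω)) ∧ η =ᵐ[μ] (fun ω => g (ζ ω))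

section CondIndicator

variable {Ω : Type*} {m1 : MeasurableSpace Ω} [m2 : MeasurableSpace Ω] {μ : Measure Ω}

lemma stronglyMeasurable_condIndicator (A : Set Ω) :
    StronglyMeasurable[m1] (condIndicator m1 μ A) :=
  stronglyMeasurable_condExp

lemma integrable_condIndicator (A : Set Ω) : Integrable (condIndicator m1 μ A) μ :=
  integrable_condExp

lemma condIndicator_empty : condIndicator m1 μ ∅ = 0 := by
  simp only [condIndicator, Set.indicator_empty]
  exact condExp_zero

variable [IsProbabilityMeasure μ]

lemma integrable_indicator_one_of_measurableSet {A : Set Ω} (hA : MeasurableSet A) :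
    Integrable (A.indicator fun _ => (1 : ℝ)) μ :=
  (integrable_const 1).indicator hA

lemma condIndicator_mono {A B : Set Ω} (hA : MeasurableSet A) (hB : MeasurableSet B)
    (h : A ⊆ B) : condIndicator m1 μ A ≤ᵐ[μ] condIndicator m1 μ B :=
  condExp_mono (integrable_indicator_one_of_measurableSet hA)
    (integrable_indicator_one_of_measurableSet hB)
    (.of_forall (Set.indicator_le_indicator_of_subset h fun _ => zero_le_one))

lemma condIndicator_union {A B : Set Ω} (hA : MeasurableSet A) (hB : MeasurableSet B)
    (h : Disjoint A B) :
    condIndicator m1 μ (A ∪ B) =ᵐ[μ] condIndicator m1 μ A + condIndicator m1 μ B := by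
  unfold condIndicator
  rw [Set.indicator_union_of_disjoint h]
  exact condExp_add (integrable_indicator_one_of_measurableSet hA)
    (integrable_indicator_one_of_measurableSet hB) m1

lemma condIndicator_add_diff {A B : Set Ω} (hA : MeasurableSet A) (hB : MeasurableSet B)
    (h : B ⊆ A) :
    condIndicator m1 μ A =ᵐ[μ] condIndicator m1 μ B + condIndicator m1 μ (A \ B) := by
  simpa [Set.union_sdiff_cancel h] using
    condIndicator_union (m1 := m1) (μ := μ) hB (hA.diff hB) Set.disjoint_sdiff_right

lemma condIndicator_univ (hm : m1 ≤ m2) : condIndicator m1 μ Set.univ = fun _ => 1 := by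
  simp only [condIndicator, Set.indicator_univ]
  exact condExp_const hm 1

lemma condIndicator_nonneg {A : Set Ω} (hA : MeasurableSet A) :
    0 ≤ᵐ[μ] condIndicator m1 μ A := by
  simpa [condIndicator_empty] using
    condIndicator_mono (m1 := m1) (μ := μ) .empty hA (Set.empty_subset A)

lemma condIndicator_le_one (hm : m1 ≤ m2) {A : Set Ω} (hA : MeasurableSet A) :
    ∀ᵐ ω ∂μ, condIndicator m1 μ A ω ≤ 1 := by
  have h := condIndicator_mono (m1 := m1) (μ := μ) hA .univ (Set.subset_univ A)
  rwa [condIndicator_univ hm] at h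

lemma condIndicator_inter {A D : Set Ω} (hA : MeasurableSet A) (hD : MeasurableSet[m1] D) :
    condIndicator m1 μ (D ∩ A) =ᵐ[μ] D.indicator (condIndicator m1 μ A) := by
  unfold condIndicator
  rw [Set.inter_comm, ← Set.inter_comm D A, ← Set.indicator_indicator]
  exact condExp_indicator (integrable_indicator_one_of_measurableSet hA) hD

lemma condIndicator_eq_on {A B D : Set Ω} (hA : MeasurableSet A) (hB : MeasurableSet B)
    (hD : MeasurableSet[m1] D) (h : D ∩ A = D ∩ B) :
    ∀ᵐ ω ∂μ, ω ∈ D → condIndicator m1 μ A ω = condIndicator m1 μ B ω := by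
  have h1 := condIndicator_inter (μ := μ) hA hD
  have h2 := condIndicator_inter (μ := μ) hB hD
  rw [h] at h1
  filter_upwards [h1, h2] with ω h1 h2 hω
  rw [h1] at h2
  simpa [hω] using h2

lemma setIntegral_condIndicator (hm : m1 ≤ m2) {A s : Set Ω} (hA : MeasurableSet A)
    (hs : MeasurableSet[m1] s) : ∫ ω in s, condIndicator m1 μ A ω ∂μ = μ.real (A ∩ s) := by
  unfold condIndicator
  rw [setIntegral_condExp hm (integrable_indicator_one_of_measurableSet hA) hs,
    integral_indicator hA]
  simp [Measure.real, Measure.restrict_apply hA]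

lemma condIndicator_iUnion_le (hm : m1 ≤ m2) {B : ℕ → Set Ω} (hB : ∀ n, MeasurableSet (B n))
    (hmono : Monotone B) {f : Ω → ℝ} (hf : StronglyMeasurable[m1] f) (hfi : Integrable f μ)
    (h : ∀ n, condIndicator m1 μ (B n) ≤ᵐ[μ] f) :
    condIndicator m1 μ (⋃ n, B n) ≤ᵐ[μ] f := by
  apply ae_le_of_ae_le_trim (hm := hm)
  refine ae_le_of_forall_setIntegral_le
    ((integrable_condIndicator _).trim hm (stronglyMeasurable_condIndicator _))
    (hfi.trim hm hf) fun s hs _ => ?_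
  rw [← setIntegral_trim hm (stronglyMeasurable_condIndicator _) hs,
    ← setIntegral_trim hm hf hs, setIntegral_condIndicator hm (.iUnion hB) hs, Set.iUnion_inter]
  have hlim := tendsto_measure_iUnion_atTop (μ := μ) (s := fun n => B n ∩ s)
    fun i j hij => Set.inter_subset_inter_left s (hmono hij)
  have hlim' := (ENNReal.tendsto_toReal (measure_ne_top μ _)).comp hlim
  refine le_of_tendsto' hlim' fun n => ?_
  change μ.real (B n ∩ s) ≤ _
  rw [← setIntegral_condIndicator hm (hB n) hs]
  exact setIntegral_mono_ae (integrable_condIndicator _).integrableOn hfi.integrableOn (h n)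

/-- Countably many subsets of `A` can be glued along `m1`-measurable sets. -/
lemma exists_condIndicator_glue (hm : m1 ≤ m2) {A : Set Ω} {B D : ℕ → Set Ω}
    (hB : ∀ n, MeasurableSet (B n)) (hBA : ∀ n, B n ⊆ A) (hD : ∀ n, MeasurableSet[m1] (D n)) :
    ∃ C, MeasurableSet C ∧ C ⊆ A ∧ ∀ᵐ ω ∂μ, ω ∈ ⋃ n, D n →
      ∃ n, ω ∈ D n ∧ condIndicator m1 μ C ω = condIndicator m1 μ (B n) ω := by
  have hE : ∀ n, MeasurableSet[m1] (disjointed D n) := MeasurableSet.disjointed hD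
  have hC : MeasurableSet (⋃ n, disjointed D n ∩ B n) :=
    .iUnion fun n => (hm _ (hE n)).inter (hB n)
  refine ⟨⋃ n, disjointed D n ∩ B n, hC,
    Set.iUnion_subset fun n => Set.inter_subset_right.trans (hBA n), ?_⟩
  have key : ∀ n, ∀ᵐ ω ∂μ, ω ∈ disjointed D n →
      condIndicator m1 μ (⋃ n, disjointed D n ∩ B n) ω = condIndicator m1 μ (B n) ω := by
    refine fun n => condIndicator_eq_on hC (hB n) (hE n) ?_
    ext ω
    simp only [Set.mem_inter_iff, Set.mem_iUnion]
    constructor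
    · rintro ⟨hn, i, hi, hiB⟩
      obtain rfl : i = n := by
        by_contra hne
        exact Set.disjoint_left.1 (disjoint_disjointed D hne) hi hn
      exact ⟨hn, hiB⟩
    · exact fun ⟨hn, hnB⟩ => ⟨hn, n, hn, hnB⟩
  filter_upwards [ae_all_iff.2 key] with ω hω hmem
  rw [← iUnion_disjointed] at hmem
  obtain ⟨n, hn⟩ := Set.mem_iUnion.1 hmem
  exact ⟨n, disjointed_subset D n hn, hω n hn⟩

lemma CondAtomless.exists_le_half (hm : m1 ≤ m2) (h : CondAtomless m1 μ) {A : Set Ω}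
    (hA : MeasurableSet A) :
    ∃ C, MeasurableSet C ∧ C ⊆ A ∧ ∀ᵐ ω ∂μ, 0 < condIndicator m1 μ A ω →
      0 < condIndicator m1 μ C ω ∧ condIndicator m1 μ C ω ≤ condIndicator m1 μ A ω / 2 := by
  obtain ⟨B, hB, hBA, hpos⟩ := h A hA
  let S : ℕ → Set Ω := fun n => if n = 0 then B else A \ B
  have hS : ∀ n, MeasurableSet (S n) := fun n => by
    dsimp only [S]; split_ifs
    exacts [hB, hA.diff hB]
  have hSA : ∀ n, S n ⊆ A := fun n => by
    dsimp only [S]; split_ifs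
    exacts [hBA, Set.sdiff_subset]
  let D : ℕ → Set Ω := fun n =>
    {ω | condIndicator m1 μ (S n) ω ≤ condIndicator m1 μ A ω / 2}
  have hD : ∀ n, MeasurableSet[m1] (D n) := fun n =>
    measurableSet_le (stronglyMeasurable_condIndicator _).measurable
      ((stronglyMeasurable_condIndicator _).measurable.div_const 2)
  obtain ⟨C, hC, hCA, hglue⟩ := exists_condIndicator_glue (μ := μ) hm hS hSA hD
  refine ⟨C, hC, hCA, ?_⟩
  filter_upwards [hpos, hglue, condIndicator_add_diff (m1 := m1) (μ := μ) hA hB hBA]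
    with ω hpos hglue hadd hω
  obtain ⟨h0, hlt⟩ := hpos hω
  simp only [Pi.add_apply] at hadd
  have hmem : ω ∈ ⋃ n, D n := by
    by_cases hle : condIndicator m1 μ B ω ≤ condIndicator m1 μ A ω / 2
    · exact Set.mem_iUnion.2 ⟨0, by simpa [D, S] using hle⟩
    · refine Set.mem_iUnion.2 ⟨1, ?_⟩
      have : condIndicator m1 μ (A \ B) ω ≤ condIndicator m1 μ A ω / 2 := by linarith
      simpa [D, S] using this
  obtain ⟨n, hn, heq⟩ := hglue hmem
  refine ⟨?_, heq ▸ hn⟩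
  rw [heq]
  dsimp only [S]
  split_ifs
  · exact h0
  · linarith

lemma CondAtomless.exists_le_half_pow (hm : m1 ≤ m2) (h : CondAtomless m1 μ) {A : Set Ω}
    (hA : MeasurableSet A) (n : ℕ) :
    ∃ C, MeasurableSet C ∧ C ⊆ A ∧ ∀ᵐ ω ∂μ, 0 < condIndicator m1 μ A ω →
      0 < condIndicator m1 μ C ω ∧
        condIndicator m1 μ C ω ≤ condIndicator m1 μ A ω / 2 ^ n := by
  induction n with
  | zero => exact ⟨A, hA, subset_rfl, .of_forall fun ω hω => ⟨hω, by simp⟩⟩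
  | succ n ih =>
    obtain ⟨C, hC, hCA, hle⟩ := ih
    obtain ⟨E, hE, hEC, hle'⟩ := h.exists_le_half hm hC
    refine ⟨E, hE, hEC.trans hCA, ?_⟩
    filter_upwards [hle, hle'] with ω hle hle' hω
    obtain ⟨h1, h2⟩ := hle hω
    obtain ⟨h3, h4⟩ := hle' h1
    refine ⟨h3, h4.trans ?_⟩
    rw [pow_succ, ← div_div]
    gcongr

/-- A family of sets closed under increasing countable unions has a member which is maximal up to
null sets. -/
lemma exists_measure_maximal {S : Set (Set Ω)} (hne : S.Nonempty)
    (hU : ∀ B : ℕ → Set Ω, (∀ n, B n ∈ S) → Monotone B → ⋃ n, B n ∈ S) :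
    ∃ B ∈ S, ∀ C ∈ S, B ⊆ C → μ.real C ≤ μ.real B := by
  have hex : ∀ (n : ℕ) (B : S), ∃ C : S, (B : Set Ω) ⊆ C ∧
      ∀ E ∈ S, (B : Set Ω) ⊆ E → μ.real E ≤ μ.real (C : Set Ω) + 1 / ((n : ℝ) + 1) := by
    intro n B
    let T : Set ℝ := {x | ∃ E ∈ S, (B : Set Ω) ⊆ E ∧ μ.real E = x}
    have hTne : T.Nonempty := ⟨_, B, B.2, subset_rfl, rfl⟩
    have hTb : BddAbove T := ⟨1, by
      rintro _ ⟨E, -, -, rfl⟩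
      exact measureReal_le_one⟩
    obtain ⟨_, ⟨C, hC, hBC, rfl⟩, hlt⟩ :=
      exists_lt_of_lt_csSup hTne (sub_lt_self (sSup T) (Nat.one_div_pos_of_nat (n := n)))
    refine ⟨⟨C, hC⟩, hBC, fun E hE hBE => ?_⟩
    have := le_csSup hTb ⟨E, hE, hBE, rfl⟩
    simp only
    linarith
  choose g hg hgle using hex
  obtain ⟨B₀, hB₀⟩ := hne
  let B : ℕ → S := fun n => Nat.rec ⟨B₀, hB₀⟩ g n
  have hmono : Monotone fun n : ℕ => (B n).1 := by
    refine monotone_nat_of_le_succ fun n => ?_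
    exact hg n (B n)
  refine ⟨⋃ n, (B n).1, hU _ (fun n => (B n).2) hmono, fun C hC hBC => ?_⟩
  have hlim := (tendsto_const_nhds (x := μ.real (⋃ n, (B n).1))).add
    (tendsto_one_div_add_atTop_nhds_zero_nat (𝕜 := ℝ))
  rw [add_zero] at hlim
  refine ge_of_tendsto' hlim fun n => ?_
  refine (hgle n (B n) C hC ((Set.subset_iUnion _ n).trans hBC)).trans ?_
  gcongr
  · exact measure_ne_top μ _
  · exact Set.subset_iUnion (fun n => (B n).1) (n + 1)

/-- Conditional version of Sierpiński's theorem on the range of an atomless measure. -/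
lemma CondAtomless.exists_condIndicator_eq (hm : m1 ≤ m2) (h : CondAtomless m1 μ) {A : Set Ω}
    (hA : MeasurableSet A) {f : Ω → ℝ} (hf : StronglyMeasurable[m1] f) (hfi : Integrable f μ)
    (hf0 : 0 ≤ᵐ[μ] f) (hfA : f ≤ᵐ[μ] condIndicator m1 μ A) :
    ∃ B, MeasurableSet B ∧ B ⊆ A ∧ condIndicator m1 μ B =ᵐ[μ] f := by
  obtain ⟨B, ⟨hB, hBA, hBf⟩, hmax⟩ := exists_measure_maximal (μ := μ)
    (S := {B | MeasurableSet B ∧ B ⊆ A ∧ condIndicator m1 μ B ≤ᵐ[μ] f})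
    ⟨∅, .empty, Set.empty_subset A, by rwa [condIndicator_empty]⟩
    (fun B hB hmono => ⟨.iUnion fun n => (hB n).1, Set.iUnion_subset fun n => (hB n).2.1,
      condIndicator_iUnion_le hm (fun n => (hB n).1) hmono hf hfi fun n => (hB n).2.2⟩)
  refine ⟨B, hB, hBA, ?_⟩
  have key : ∀ n : ℕ, ∀ᵐ ω ∂μ, ¬ condIndicator m1 μ B ω + 1 / 2 ^ n ≤ f ω := by
    intro n
    obtain ⟨C, hC, hCA, hCle⟩ := h.exists_le_half_pow hm (hA.diff hB) n
    let D : Set Ω := {ω | condIndicator m1 μ B ω + 1 / 2 ^ n ≤ f ω}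
    have hD : MeasurableSet[m1] D :=
      measurableSet_le ((stronglyMeasurable_condIndicator _).measurable.add_const _) hf.measurable
    have hDC : MeasurableSet (D ∩ C) := (hm _ hD).inter hC
    have hdisj : Disjoint B (D ∩ C) :=
      Set.disjoint_left.2 fun ω hω hω' => (hCA hω'.2).2 hω
    have hle : condIndicator m1 μ (B ∪ D ∩ C) ≤ᵐ[μ] f := by
      filter_upwards [condIndicator_union (m1 := m1) (μ := μ) hB hDC hdisj,
        condIndicator_inter (μ := μ) hC hD, hCle, hBf, condIndicator_nonneg (m1 := m1) hC,
        condIndicator_mono (m1 := m1) (μ := μ) hC (hA.diff hB) hCA,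
        condIndicator_le_one (μ := μ) hm (hA.diff hB)] with ω h1 h2 h3 h4 h5 h6 h7
      rw [h1, Pi.add_apply, h2]
      by_cases hω : ω ∈ D
      · rw [Set.indicator_of_mem hω]
        have hωD : condIndicator m1 μ B ω + 1 / 2 ^ n ≤ f ω := hω
        refine le_trans ?_ hωD
        gcongr
        by_cases hpos : 0 < condIndicator m1 μ (A \ B) ω
        · exact (h3 hpos).2.trans (by gcongr)
        · exact (h6.trans (not_lt.1 hpos)).trans (by positivity)
      · rw [Set.indicator_of_notMem hω, add_zero]
        exact h4
    have hreal := hmax (B ∪ D ∩ C) ⟨hB.union hDC, Set.union_subset hBA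
      fun ω hω => (hCA hω.2).1, hle⟩ Set.subset_union_left
    rw [measureReal_union hdisj hDC] at hreal
    have hzero : μ (D ∩ C) = 0 := by
      have : μ.real (D ∩ C) = 0 := le_antisymm (by linarith) measureReal_nonneg
      exact (measureReal_eq_zero_iff).1 this
    have hcond : condIndicator m1 μ (D ∩ C) =ᵐ[μ] 0 := by
      have h1 : (D ∩ C).indicator (fun _ => (1 : ℝ)) =ᵐ[μ] 0 :=
        indicator_meas_zero hzero
      have h2 := condExp_congr_ae (m := m1) h1
      rwa [condExp_zero] at h2
    filter_upwards [hcond, condIndicator_inter (μ := μ) hC hD, hCle, hfA,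
      condIndicator_add_diff (m1 := m1) (μ := μ) hA hB hBA] with ω h1 h2 h3 h4 h5 hω
    have hωD : ω ∈ D := hω
    rw [h1, Set.indicator_of_mem hωD] at h2
    simp only [Pi.add_apply] at h5
    have : (0 : ℝ) < 1 / 2 ^ n := by positivity
    have := (h3 (by linarith)).1
    simp only [Pi.zero_apply] at h2
    linarith
  filter_upwards [hBf, ae_all_iff.2 key] with ω h1 h2
  refine le_antisymm h1 (not_lt.1 fun hlt => ?_)
  obtain ⟨n, hn⟩ := exists_pow_lt_of_lt_one (sub_pos.2 hlt) (by norm_num : (1 / 2 : ℝ) < 1)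
  refine h2 n ?_
  rw [one_div_pow] at hn
  linarith

lemma CondAtomless.exists_half (hm : m1 ≤ m2) (h : CondAtomless m1 μ) {A : Set Ω}
    (hA : MeasurableSet A) :
    ∃ B, MeasurableSet B ∧ B ⊆ A ∧
      ∀ᵐ ω ∂μ, condIndicator m1 μ B ω = condIndicator m1 μ A ω / 2 := by
  have h0 := condIndicator_nonneg (m1 := m1) (μ := μ) hA
  refine h.exists_condIndicator_eq hm hA
    (f := fun ω => condIndicator m1 μ A ω / 2) ?_ ((integrable_condIndicator A).div_const 2) ?_ ?_
  · exact ((stronglyMeasurable_condIndicator A).measurable.div_const 2).stronglyMeasurable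
  · filter_upwards [h0] with ω hω
    simp only [Pi.zero_apply] at hω ⊢
    positivity
  · filter_upwards [h0] with ω hω
    simp only [Pi.zero_apply] at hω
    linarith

/-- Each level set of a random integer can be split into two halves. -/
lemma CondAtomless.exists_refinement (hm : m1 ≤ m2) (h : CondAtomless m1 μ) {K : Ω → ℕ}
    (hK : Measurable K) :
    ∃ L : Ω → ℕ, Measurable L ∧ (∀ ω, L ω / 2 = K ω) ∧
      ∀ j, ∀ᵐ ω ∂μ, condIndicator m1 μ {ω | L ω = j} ω =
        condIndicator m1 μ {ω | K ω = j / 2} ω / 2 := by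
  have hKm : ∀ j, MeasurableSet {ω | K ω = j} := fun j => hK (measurableSet_singleton j)
  choose H hH hHK hhalf using fun j => h.exists_half hm (hKm j)
  have hmem : ∀ j ω, ω ∈ H j ↔ ω ∈ ⋃ i, H i ∧ K ω = j := by
    refine fun j ω => ⟨fun hω => ⟨Set.mem_iUnion.2 ⟨j, hω⟩, hHK j hω⟩, fun ⟨hω, hj⟩ => ?_⟩
    obtain ⟨i, hi⟩ := Set.mem_iUnion.1 hω
    have : K ω = i := hHK i hi
    rwa [← hj, this]
  refine ⟨fun ω => 2 * K ω + (⋃ i, H i).indicator (fun _ => 1) ω,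
    (hK.const_mul 2).add (measurable_const.indicator (.iUnion hH)), fun ω => ?_, fun j => ?_⟩
  · beta_reduce
    by_cases hω : ω ∈ ⋃ i, H i
    · rw [Set.indicator_of_mem hω]; omega
    · rw [Set.indicator_of_notMem hω]; omega
  · rcases Nat.even_or_odd' j with ⟨i, rfl | rfl⟩
    · have hset : {ω | 2 * K ω + (⋃ i, H i).indicator (fun _ => 1) ω = 2 * i} =
          {ω | K ω = i} \ H i := by
        ext ω
        simp only [Set.mem_sdiff, Set.mem_ofPred_eq, hmem i ω]
        by_cases hω : ω ∈ ⋃ i, H i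
        · rw [Set.indicator_of_mem hω]; simp only [hω, true_and]; omega
        · rw [Set.indicator_of_notMem hω]; simp only [hω, false_and, not_false_eq_true, and_true]; omega
      have hdiv : 2 * i / 2 = i := by omega
      rw [hset, hdiv]
      filter_upwards [hhalf i, condIndicator_add_diff (m1 := m1) (μ := μ) (hKm i) (hH i) (hHK i)]
        with ω h1 h2
      simp only [Pi.add_apply] at h2
      linarith
    · have hset : {ω | 2 * K ω + (⋃ i, H i).indicator (fun _ => 1) ω = 2 * i + 1} = H i := by
        ext ω
        simp only [Set.mem_ofPred_eq, hmem i ω]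
        by_cases hω : ω ∈ ⋃ i, H i
        · rw [Set.indicator_of_mem hω]; simp only [hω, true_and]; omega
        · rw [Set.indicator_of_notMem hω]; simp only [hω, false_and, iff_false]; omega
      have hdiv : (2 * i + 1) / 2 = i := by omega
      rw [hset, hdiv]
      exact hhalf i

/-- The dyadic approximations `K n` of `2 ^ n * U` for the uniform variable `U` to be built. -/
lemma CondAtomless.exists_dyadic (hm : m1 ≤ m2) (h : CondAtomless m1 μ) :
    ∃ K : ℕ → Ω → ℕ, (∀ n, Measurable (K n)) ∧ (∀ ω, K 0 ω = 0) ∧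
      (∀ n ω, K (n + 1) ω / 2 = K n ω) ∧
      ∀ n j, j < 2 ^ n → ∀ᵐ ω ∂μ, condIndicator m1 μ {ω | K n ω = j} ω = 1 / 2 ^ n := by
  choose g hg hdiv hcond using fun K : {K : Ω → ℕ // Measurable K} =>
    h.exists_refinement hm K.2
  let K : ℕ → {K : Ω → ℕ // Measurable K} := fun n =>
    Nat.rec ⟨fun _ => 0, measurable_const⟩ (fun _ L => ⟨g L, hg L⟩) n
  refine ⟨fun n => (K n).1, fun n => (K n).2, fun ω => rfl, fun n => ?_, fun n => ?_⟩
  · exact hdiv (K n)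
  induction n with
  | zero =>
    intro j hj
    obtain rfl : j = 0 := by simpa using hj
    have : {ω | (K 0).1 ω = 0} = Set.univ := Set.eq_univ_of_forall fun ω => rfl
    rw [this, condIndicator_univ hm]
    simp
  | succ n ih =>
    intro j hj
    filter_upwards [hcond (K n) j, ih (j / 2) (by rw [pow_succ] at hj; omega)] with ω h1 h2
    change condIndicator m1 μ {ω | g (K n) ω = j} ω = _
    rw [h1, h2, pow_succ, div_div]

lemma condIndicator_lt_of_condIndicator_eq {K : Ω → ℕ} (hK : Measurable K) {N : ℕ} {c : ℝ}
    (h : ∀ j < N, ∀ᵐ ω ∂μ, condIndicator m1 μ {ω | K ω = j} ω = c) {m : ℕ} (hmN : m ≤ N) :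
    ∀ᵐ ω ∂μ, condIndicator m1 μ {ω | K ω < m} ω = m * c := by
  induction m with
  | zero => simp [condIndicator_empty]
  | succ m ih =>
    have hset : {ω | K ω < m + 1} = {ω | K ω < m} ∪ {ω | K ω = m} := by
      ext ω; simp only [Set.mem_ofPred_eq, Set.mem_union]; omega
    have hdisj : Disjoint {ω | K ω < m} {ω | K ω = m} :=
      Set.disjoint_left.2 fun ω h1 h2 => by simp only [Set.mem_ofPred_eq] at h1 h2; omega
    rw [hset]
    filter_upwards [ih (by omega), h m (by omega), condIndicator_union (m1 := m1) (μ := μ)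
      (hK measurableSet_Iio) (hK (measurableSet_singleton m)) hdisj] with ω h1 h2 h3
    refine h3.trans ?_
    rw [Pi.add_apply]
    push_cast
    rw [add_mul, one_mul]
    exact congrArg₂ (· + ·) h1 h2

lemma CondAtomless.exists_uniform (hm : m1 ≤ m2) (h : CondAtomless m1 μ) :
    ∃ U : Ω → ℝ, Measurable U ∧ (∀ ω, U ω ∈ Set.Icc (0 : ℝ) 1) ∧
      ∀ t ∈ Set.Icc (0 : ℝ) 1, condIndicator m1 μ {ω | U ω ≤ t} =ᵐ[μ] fun _ => t := by
  obtain ⟨K, hK, hK0, hKdiv, hKc⟩ := h.exists_dyadic hm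
  have hlow : ∀ ω, Monotone fun n => (K n ω : ℝ) / 2 ^ n := fun ω =>
    monotone_nat_of_le_succ fun n => by
      have : 2 * K n ω ≤ K (n + 1) ω := by have := hKdiv n ω; omega
      have : 2 * (K n ω : ℝ) ≤ K (n + 1) ω := by exact_mod_cast this
      rw [pow_succ, div_le_div_iff₀ (by positivity) (by positivity)]
      nlinarith [pow_pos (zero_lt_two' ℝ) n]
  have hupp : ∀ ω, Antitone fun n => ((K n ω : ℝ) + 1) / 2 ^ n := fun ω =>
    antitone_nat_of_succ_le fun n => by
      have : K (n + 1) ω ≤ 2 * K n ω + 1 := by have := hKdiv n ω; omega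
      have : (K (n + 1) ω : ℝ) ≤ 2 * K n ω + 1 := by exact_mod_cast this
      rw [pow_succ, div_le_div_iff₀ (by positivity) (by positivity)]
      nlinarith [pow_pos (zero_lt_two' ℝ) n]
  have hlu : ∀ ω m n, (K m ω : ℝ) / 2 ^ m ≤ ((K n ω : ℝ) + 1) / 2 ^ n := fun ω m n =>
    calc (K m ω : ℝ) / 2 ^ m ≤ K (max m n) ω / 2 ^ max m n := hlow ω (le_max_left m n)
      _ ≤ (K (max m n) ω + 1) / 2 ^ max m n := by gcongr; linarith
      _ ≤ _ := hupp ω (le_max_right m n)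
  let U : Ω → ℝ := fun ω => ⨆ n, (K n ω : ℝ) / 2 ^ n
  have hbdd : ∀ ω, BddAbove (Set.range fun n => (K n ω : ℝ) / 2 ^ n) := fun ω =>
    ⟨_, by rintro _ ⟨m, rfl⟩; exact hlu ω m 0⟩
  have hKU : ∀ ω n, (K n ω : ℝ) / 2 ^ n ≤ U ω := fun ω n => le_ciSup (hbdd ω) n
  have hUK : ∀ ω n, U ω ≤ ((K n ω : ℝ) + 1) / 2 ^ n := fun ω n => ciSup_le fun m => hlu ω m n
  have hU : Measurable U := .iSup fun n =>
    (measurable_from_nat.comp (hK n) : Measurable fun ω => ((K n ω : ℕ) : ℝ)).div_const _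
  refine ⟨U, hU, fun ω => ⟨?_, ?_⟩, fun t ht => ?_⟩
  · simpa [hK0] using hKU ω 0
  · simpa [hK0] using hUK ω 0
  have hUt : MeasurableSet {ω | U ω ≤ t} := hU measurableSet_Iic
  have key : ∀ n : ℕ, ∀ᵐ ω ∂μ, t - (1 / 2) ^ n ≤ condIndicator m1 μ {ω | U ω ≤ t} ω ∧
      condIndicator m1 μ {ω | U ω ≤ t} ω ≤ t + (1 / 2) ^ n := by
    intro n
    have h2 : (0 : ℝ) < 2 ^ n := by positivity
    set m := ⌊2 ^ n * t⌋₊ with hmdef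
    have hmle : (m : ℝ) ≤ 2 ^ n * t := Nat.floor_le (by have := ht.1; positivity)
    have hmlt : 2 ^ n * t < m + 1 := Nat.lt_floor_add_one _
    have hm2 : m ≤ 2 ^ n := by
      have : (m : ℝ) ≤ 2 ^ n := hmle.trans (mul_le_of_le_one_right h2.le ht.2)
      exact_mod_cast this
    have hsub1 : {ω | K n ω < m} ⊆ {ω | U ω ≤ t} := fun ω hω => by
      have : (K n ω : ℝ) + 1 ≤ m := by exact_mod_cast Nat.succ_le_of_lt hω
      refine (hUK ω n).trans ?_
      rw [div_le_iff₀ h2]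
      linarith
    have hsub2 : {ω | U ω ≤ t} ⊆ {ω | K n ω < m + 1} := fun ω hω => by
      have h3 := (hKU ω n).trans hω
      rw [div_le_iff₀ h2] at h3
      have : (K n ω : ℝ) < (m + 1 : ℕ) := by push_cast; linarith
      exact_mod_cast this
    have hupper : ∀ᵐ ω ∂μ, condIndicator m1 μ {ω | K n ω < m + 1} ω ≤ (m + 1) * (1 / 2 ^ n) := by
      by_cases hlt : m + 1 ≤ 2 ^ n
      · filter_upwards [condIndicator_lt_of_condIndicator_eq (hK n) (hKc n) hlt] with ω hω
        rw [hω]; push_cast; rfl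
      · have : (2 : ℝ) ^ n ≤ m + 1 := by exact_mod_cast (not_le.1 hlt).le
        filter_upwards [condIndicator_le_one (m1 := m1) (μ := μ) hm
          (hK n (measurableSet_Iio (a := m + 1)))] with ω hω
        refine le_trans hω ?_
        rw [mul_one_div, le_div_iff₀ h2]
        linarith
    filter_upwards [condIndicator_lt_of_condIndicator_eq (hK n) (hKc n) hm2, hupper,
      condIndicator_mono (m1 := m1) (μ := μ) (hK n measurableSet_Iio) hUt hsub1,
      condIndicator_mono (m1 := m1) (μ := μ) hUt (hK n measurableSet_Iio) hsub2]
      with ω h3 h4 h5 h6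
    have hinv : (2 : ℝ) ^ n * (1 / 2 ^ n) = 1 := by field_simp
    have hinv0 : (0 : ℝ) < 1 / 2 ^ n := by positivity
    rw [one_div_pow]
    constructor
    · refine le_trans ?_ (h3.symm.le.trans h5)
      nlinarith
    · refine (le_trans h6 h4).trans ?_
      nlinarith
  filter_upwards [ae_all_iff.2 key] with ω hω
  have hlim : Filter.Tendsto (fun n : ℕ => (1 / 2 : ℝ) ^ n) Filter.atTop (nhds 0) :=
    tendsto_pow_atTop_nhds_zero_of_lt_one (by norm_num) (by norm_num)
  have hl1 := hlim.const_sub t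
  have hl2 := hlim.const_add t
  rw [sub_zero] at hl1
  rw [add_zero] at hl2
  exact le_antisymm (ge_of_tendsto' hl2 fun n => (hω n).2) (le_of_tendsto' hl1 fun n => (hω n).1)

lemma measureReal_inter_of_condIndicator_eq {U : Ω → ℝ} (hU : Measurable U)
    (hc : ∀ t ∈ Set.Icc (0 : ℝ) 1, condIndicator m1 μ {ω | U ω ≤ t} =ᵐ[μ] fun _ => t)
    (hm : m1 ≤ m2) {t : ℝ} (ht : t ∈ Set.Icc (0 : ℝ) 1)
    {s : Set Ω} (hs : MeasurableSet[m1] s) :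
    μ.real ({ω | U ω ≤ t} ∩ s) = t * μ.real s := by
  have hUt : MeasurableSet {ω | U ω ≤ t} := hU measurableSet_Iic
  rw [← setIntegral_condIndicator hm hUt hs,
    integral_congr_ae (ae_restrict_of_ae (hc t ht))]
  simp [mul_comm]

lemma map_eq_of_condIndicator_eq {U : Ω → ℝ} (hU : Measurable U)
    (hU01 : ∀ ω, U ω ∈ Set.Icc (0 : ℝ) 1)
    (hc : ∀ t ∈ Set.Icc (0 : ℝ) 1, condIndicator m1 μ {ω | U ω ≤ t} =ᵐ[μ] fun _ => t)
    (hm : m1 ≤ m2) :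
    μ.map U = (volume : Measure ℝ).restrict (Set.Icc 0 1) := by
  have := Measure.isProbabilityMeasure_map (μ := μ) hU.aemeasurable
  refine Measure.ext_of_Iic _ _ fun t => ?_
  rw [Measure.map_apply hU measurableSet_Iic, Measure.restrict_apply measurableSet_Iic]
  change μ {ω | U ω ≤ t} = _
  rcases lt_or_ge t 0 with h0 | h0
  · have h1 : {ω | U ω ≤ t} = ∅ := Set.eq_empty_of_forall_notMem fun ω hω =>
      absurd (h0.trans_le (hU01 ω).1) (not_lt.2 hω)
    have h2 : Set.Iic t ∩ Set.Icc 0 1 = ∅ := Set.eq_empty_of_forall_notMem fun x hx =>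
      absurd (h0.trans_le hx.2.1) (not_lt.2 hx.1)
    rw [h1, h2, measure_empty, measure_empty]
  rcases le_or_gt t 1 with h1 | h1
  · have h2 : Set.Iic t ∩ Set.Icc 0 1 = Set.Icc 0 t := by
      ext x
      simp only [Set.mem_inter_iff, Set.mem_Iic, Set.mem_Icc]
      exact ⟨fun hx => ⟨hx.2.1, hx.1⟩, fun hx => ⟨hx.2, hx.1, hx.2.trans h1⟩⟩
    have h3 := measureReal_inter_of_condIndicator_eq hU hc hm ⟨h0, h1⟩ .univ
    rw [Set.inter_univ, probReal_univ, mul_one] at h3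
    rw [h2, Real.volume_Icc, sub_zero, ← ofReal_measureReal (s := {ω | U ω ≤ t}), h3]
  · have h2 : {ω | U ω ≤ t} = Set.univ := Set.eq_univ_of_forall fun ω => (hU01 ω).2.trans h1.le
    have h3 : Set.Iic t ∩ Set.Icc 0 1 = Set.Icc 0 1 :=
      Set.inter_eq_right.2 fun x hx => hx.2.trans h1.le
    rw [h2, h3]
    simp

lemma indep_of_condIndicator_eq {U : Ω → ℝ} (hU : Measurable U)
    (hU01 : ∀ ω, U ω ∈ Set.Icc (0 : ℝ) 1)
    (hc : ∀ t ∈ Set.Icc (0 : ℝ) 1, condIndicator m1 μ {ω | U ω ≤ t} =ᵐ[μ] fun _ => t)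
    (hm : m1 ≤ m2) :
    Indep (MeasurableSpace.comap U inferInstance) m1 μ := by
  refine IndepSets.indep hU.comap_le hm
    (((Set.image_univ (f := (Set.Iic : ℝ → Set ℝ))) ▸ isPiSystem_image_Iic Set.univ).comap U)
    (@MeasurableSpace.isPiSystem_measurableSet Ω m1) ?_
    (@MeasurableSpace.generateFrom_measurableSet Ω m1).symm ?_
  · rw [BorelSpace.measurable_eq (α := ℝ), borel_eq_generateFrom_Iic,
      MeasurableSpace.comap_generateFrom]
    rfl
  · rw [IndepSets_iff]
    rintro _ s ⟨_, ⟨t, rfl⟩, rfl⟩ hs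
    change μ ({ω | U ω ≤ t} ∩ s) = μ {ω | U ω ≤ t} * μ s
    rcases lt_or_ge t 0 with h0 | h0
    · have h1 : {ω | U ω ≤ t} = ∅ := Set.eq_empty_of_forall_notMem fun ω hω =>
        absurd (h0.trans_le (hU01 ω).1) (not_lt.2 hω)
      simp [h1]
    rcases le_or_gt t 1 with h1 | h1
    · have h2 := measureReal_inter_of_condIndicator_eq hU hc hm ⟨h0, h1⟩ hs
      have h3 := measureReal_inter_of_condIndicator_eq hU hc hm ⟨h0, h1⟩ .univ
      rw [Set.inter_univ, probReal_univ, mul_one] at h3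
      rw [← ofReal_measureReal (s := {ω | U ω ≤ t} ∩ s), h2, ENNReal.ofReal_mul h0,
        ofReal_measureReal, ← ofReal_measureReal (s := {ω | U ω ≤ t}), h3]
    · have h2 : {ω | U ω ≤ t} = Set.univ :=
        Set.eq_univ_of_forall fun ω => (hU01 ω).2.trans h1.le
      simp [h2]

lemma condAtomless_of_condIndicator_eq {U : Ω → ℝ} (hU : Measurable U)
    (hU01 : ∀ ω, U ω ∈ Set.Icc (0 : ℝ) 1)
    (hc : ∀ t ∈ Set.Icc (0 : ℝ) 1, condIndicator m1 μ {ω | U ω ≤ t} =ᵐ[μ] fun _ => t)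
    (hm : m1 ≤ m2) : CondAtomless m1 μ := by
  intro A hA
  let V : ℝ → Set Ω := fun t => {ω | U ω ≤ t}
  have hV : ∀ t, MeasurableSet (V t) := fun t => hU measurableSet_Iic
  have hAV : ∀ t, MeasurableSet (A ∩ V t) := fun t => hA.inter (hV t)
  let q : ℕ → ℕ → ℝ := fun n k => k / (n + 1)
  have hinc : ∀ n k, ∀ᵐ ω ∂μ, k + 1 ≤ n + 1 → condIndicator m1 μ (A ∩ V (q n (k + 1))) ω ≤
      condIndicator m1 μ (A ∩ V (q n k)) ω + 1 / (n + 1) := by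
    intro n k
    by_cases hk : k + 1 ≤ n + 1
    swap
    · exact .of_forall fun ω h => absurd h hk
    have hk' : (k : ℝ) + 1 ≤ n + 1 := by exact_mod_cast hk
    have hn : (0 : ℝ) < n + 1 := by positivity
    have hq : q n k ≤ q n (k + 1) := by
      simp only [q]; gcongr; exact Nat.le_succ k
    have hq0 : 0 ≤ q n k := by positivity
    have hq1 : q n (k + 1) ≤ 1 := by
      simp only [q]; rw [div_le_one hn]; push_cast; exact hk'
    have hqd : q n (k + 1) = q n k + 1 / (n + 1) := by
      simp only [q]; push_cast; ring
    have hVV : V (q n k) ⊆ V (q n (k + 1)) := fun ω hω => le_trans hω hq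
    have hdiff := (hV (q n (k + 1))).diff (hV (q n k))
    have hdisj : Disjoint (A ∩ V (q n k)) (V (q n (k + 1)) \ V (q n k)) :=
      Set.disjoint_left.2 fun ω h1 h2 => h2.2 h1.2
    have hsub : A ∩ V (q n (k + 1)) ⊆ A ∩ V (q n k) ∪ V (q n (k + 1)) \ V (q n k) := by
      intro ω hω
      by_cases h : ω ∈ V (q n k)
      exacts [.inl ⟨hω.1, h⟩, .inr ⟨hω.2, h⟩]
    filter_upwards [condIndicator_mono (m1 := m1) (μ := μ) (hAV _) ((hAV _).union hdiff) hsub,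
      condIndicator_union (m1 := m1) (μ := μ) (hAV _) hdiff hdisj,
      condIndicator_add_diff (m1 := m1) (μ := μ) (hV _) (hV _) hVV,
      hc _ ⟨hq0, hq.trans hq1⟩, hc _ ⟨hq0.trans hq, hq1⟩] with ω h1 h2 h3 h4 h5 _
    rw [h2] at h1
    simp only [Pi.add_apply] at h1 h3
    change condIndicator m1 μ (V _) ω = _ at h4 h5
    rw [h4, h5] at h3
    linarith
  have hzero : ∀ᵐ ω ∂μ, condIndicator m1 μ (A ∩ V 0) ω ≤ 0 := by
    filter_upwards [condIndicator_mono (m1 := m1) (μ := μ) (hAV 0) (hV 0) Set.inter_subset_right,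
      hc 0 (by simp)] with ω h1 h2
    exact h1.trans h2.le
  have hone : A ∩ V 1 = A := Set.inter_eq_left.2 fun ω _ => (hU01 ω).2
  let B : ℕ → Set Ω := fun i => A ∩ V (q i.unpair.1 i.unpair.2)
  let D : ℕ → Set Ω := fun i => {ω | 0 < condIndicator m1 μ (B i) ω} ∩
    {ω | condIndicator m1 μ (B i) ω < condIndicator m1 μ A ω}
  have hD : ∀ i, MeasurableSet[m1] (D i) := fun i =>
    MeasurableSet.inter
      (measurableSet_lt measurable_const (stronglyMeasurable_condIndicator _).measurable)
      (measurableSet_lt (stronglyMeasurable_condIndicator _).measurable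
        (stronglyMeasurable_condIndicator _).measurable)
  obtain ⟨C, hC, hCA, hglue⟩ := exists_condIndicator_glue (μ := μ) (B := B) hm
    (fun i => hAV _) (fun i => Set.inter_subset_left) hD
  refine ⟨C, hC, hCA, ?_⟩
  filter_upwards [hglue, hzero, ae_all_iff.2 fun n => ae_all_iff.2 (hinc n)]
    with ω hglue hzero hinc hω
  suffices hmem : ω ∈ ⋃ i, D i by
    obtain ⟨i, hi, heq⟩ := hglue hmem
    rw [heq]
    exact hi
  obtain ⟨n, hn⟩ := exists_nat_one_div_lt hω
  have hex : ∃ k, 0 < condIndicator m1 μ (A ∩ V (q n k)) ω := by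
    refine ⟨n + 1, ?_⟩
    have : q n (n + 1) = 1 := by
      simp only [q]; push_cast; exact div_self (by positivity)
    rwa [this, hone]
  have hfind : Nat.find hex ≤ n + 1 := Nat.find_min' hex (by
    have : q n (n + 1) = 1 := by
      simp only [q]; push_cast; exact div_self (by positivity)
    rwa [this, hone])
  have hpos := Nat.find_spec hex
  have hmin := fun k => Nat.find_min hex (m := k)
  generalize Nat.find hex = k at hfind hpos hmin
  obtain _ | k := k
  · simp only [q, Nat.cast_zero, zero_div] at hpos
    exact absurd hpos (not_lt.2 hzero)
  refine Set.mem_iUnion.2 ⟨Nat.pair n (k + 1), ?_⟩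
  have h1 := not_lt.1 (hmin k (Nat.lt_succ_self k))
  have h2 := hinc n k hfind
  have h3 : condIndicator m1 μ (A ∩ V (q n (k + 1))) ω < condIndicator m1 μ A ω := by linarith
  simp only [D, B, Nat.unpair_pair]
  exact ⟨hpos, h3⟩

end CondIndicator

theorem condAtomless_iff_exists_uniform_family {Ω : Type*} (m1 : MeasurableSpace Ω)
    [m2 : MeasurableSpace Ω] (hm : m1 ≤ m2) (μ : Measure Ω) [IsProbabilityMeasure μ] :
    CondAtomless m1 μ ↔
      ∃ U : Ω → ℝ, Measurable U ∧ (∀ ω, U ω ∈ Set.Icc (0 : ℝ) 1) ∧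
        μ.map U = (volume : Measure ℝ).restrict (Set.Icc 0 1) ∧
        @Indep Ω (MeasurableSpace.comap U inferInstance) m1 m2 μ ∧
        ∀ t ∈ Set.Icc (0 : ℝ) 1,
          condIndicator m1 μ {ω | U ω ≤ t} =ᵐ[μ] fun _ => t := by
  constructor
  · intro h
    obtain ⟨U, hU, hU01, hc⟩ := h.exists_uniform hm
    exact ⟨U, hU, hU01, map_eq_of_condIndicator_eq hU hU01 hc hm,
      indep_of_condIndicator_eq hU hU01 hc hm, hc⟩
  · rintro ⟨U, hU, hU01, -, -, hc⟩
    exact condAtomless_of_condIndicator_eq hU hU01 hc hm
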